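/- For k > 0 define g_k : ℝ^{2×2} → ℝ by g_k(F) = |F₁₁ − F₂₂| + |F₁₂ + F₂₁| + max(2k − |F₁₁ + F₂₂|, 0). There exist c₁ > 0 and k₀ > 0 such that for all k ≥ k₀, inf { ∫_Q g_k(Dφ(x)) dx : φ : Q → ℝ² smooth with compact support in Q } ≥ c₁ k, where Q = (0,1)² is the open unit square and Dφ(x) ∈ ℝ^{2×2} is the Jacobian matrix of φ at x. (This infimum equals the value at 0 of the quasiconvex envelope Qg_k.) -/

import Mathlib

open MeasureTheory

/-- The open unit cube `(0,1)^n` in `ℝⁿ`. -/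
def unitCube (n : ℕ) : Set (Fin n → ℝ) := Set.univ.pi fun _ => Set.Ioo (0 : ℝ) 1

/-- The Jacobian matrix of a map `φ : ℝⁿ → ℝᵐ` at a point `x`. -/
noncomputable def jacobianMatrix {m n : ℕ} (φ : (Fin n → ℝ) → (Fin m → ℝ))
    (x : Fin n → ℝ) : Matrix (Fin m) (Fin n) ℝ :=
  Matrix.of fun i j => fderiv ℝ φ x (Pi.single j 1) i

/-- The function `g_k` of Müller's example. -/
noncomputable def gk (k : ℝ) (F : Matrix (Fin 2) (Fin 2) ℝ) : ℝ :=
  |F 0 0 - F 1 1| + |F 0 1 + F 1 0| + max (2 * k - |F 0 0 + F 1 1|) 0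

/-- The Wirtinger derivative of `f` with respect to `z`. -/
noncomputable def dz (f : ℂ → ℂ) (z : ℂ) : ℂ :=
  (fderiv ℝ f z 1 - Complex.I * fderiv ℝ f z Complex.I) / 2

/-- The Wirtinger derivative of `f` with respect to the conjugate variable. -/
noncomputable def dzbar (f : ℂ → ℂ) (z : ℂ) : ℂ :=
  (fderiv ℝ f z 1 + Complex.I * fderiv ℝ f z Complex.I) / 2

lemma ContDiff.fderiv_apply_smooth {f : ℂ → ℂ} (hf : ContDiff ℝ (⊤ : ℕ∞) f) (v : ℂ) :
    ContDiff ℝ (⊤ : ℕ∞) fun z => fderiv ℝ f z v :=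
  (hf.fderiv_right (m := (⊤ : ℕ∞)) (by simp)).clm_apply contDiff_const

lemma ContDiff.dz {f : ℂ → ℂ} (hf : ContDiff ℝ (⊤ : ℕ∞) f) :
    ContDiff ℝ (⊤ : ℕ∞) (dz f) :=
  ((hf.fderiv_apply_smooth 1).sub
    (contDiff_const.mul (hf.fderiv_apply_smooth Complex.I))).div_const 2

lemma ContDiff.dzbar {f : ℂ → ℂ} (hf : ContDiff ℝ (⊤ : ℕ∞) f) :
    ContDiff ℝ (⊤ : ℕ∞) (dzbar f) :=
  ((hf.fderiv_apply_smooth 1).add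
    (contDiff_const.mul (hf.fderiv_apply_smooth Complex.I))).div_const 2

lemma dz_eq_zero_of_notMem_tsupport {f : ℂ → ℂ} {z : ℂ} (hz : z ∉ tsupport f) :
    dz f z = 0 := by
  have h : fderiv ℝ f z = 0 := by
    by_contra h
    exact hz (support_fderiv_subset ℝ h)
  simp [dz, h]

lemma dzbar_eq_zero_of_notMem_tsupport {f : ℂ → ℂ} {z : ℂ} (hz : z ∉ tsupport f) :
    dzbar f z = 0 := by
  have h : fderiv ℝ f z = 0 := by
    by_contra h
    exact hz (support_fderiv_subset ℝ h)
  simp [dzbar, h]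

lemma HasCompactSupport.dz {f : ℂ → ℂ} (hf : HasCompactSupport f) : HasCompactSupport (dz f) :=
  HasCompactSupport.intro' hf (isClosed_tsupport f) fun _ => dz_eq_zero_of_notMem_tsupport

lemma HasCompactSupport.dzbar {f : ℂ → ℂ} (hf : HasCompactSupport f) :
    HasCompactSupport (dzbar f) :=
  HasCompactSupport.intro' hf (isClosed_tsupport f) fun _ => dzbar_eq_zero_of_notMem_tsupport

lemma integral_fderiv_mul_fderiv_comm {f g : ℂ → ℂ} (hf : ContDiff ℝ (⊤ : ℕ∞) f)
    (hfc : HasCompactSupport f) (hg : ContDiff ℝ (⊤ : ℕ∞) g) (v w : ℂ) :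
    ∫ z, fderiv ℝ f z v * fderiv ℝ g z w = ∫ z, fderiv ℝ f z w * fderiv ℝ g z v := by
  have key : ∀ v w : ℂ, ∫ z, f z * fderiv ℝ (fun y => fderiv ℝ g y w) z v =
      - ∫ z, fderiv ℝ f z v * fderiv ℝ g z w := by
    intro v w
    have c1 := hf.continuous
    have c2 := (hf.fderiv_apply_smooth v).continuous
    have c3 := (hg.fderiv_apply_smooth w).continuous
    have c4 := ((hg.fderiv_apply_smooth w).fderiv_apply_smooth v).continuous
    refine integral_mul_fderiv_eq_neg_fderiv_mul_of_integrable
      (g := fun y => fderiv ℝ g y w) ?_ ?_ ?_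
      (fun z _ => hf.differentiable (by simp) z)
      (fun z _ => (hg.fderiv_apply_smooth w).differentiable (by simp) z)
    · exact (c2.mul c3).integrable_of_hasCompactSupport (hfc.fderiv_apply ℝ v).mul_right
    · exact (c1.mul c4).integrable_of_hasCompactSupport hfc.mul_right
    · exact (c1.mul c3).integrable_of_hasCompactSupport hfc.mul_right
  have hsymm : ∀ z, fderiv ℝ (fun y => fderiv ℝ g y w) z v =
      fderiv ℝ (fun y => fderiv ℝ g y v) z w := by
    intro z
    have hd : DifferentiableAt ℝ (fderiv ℝ g) z :=
      ((hg.fderiv_right (m := (⊤ : ℕ∞)) (by simp)).differentiable (by simp)) z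
    have hs : IsSymmSndFDerivAt ℝ g z :=
      hg.contDiffAt.isSymmSndFDerivAt (by simp; norm_cast)
    rw [fderiv_clm_apply hd (by fun_prop), fderiv_clm_apply hd (by fun_prop)]
    simpa using hs v w
  have h1 := key v w
  have h2 := key w v
  simp_rw [hsymm] at h1
  rw [h1] at h2
  exact neg_injective h2

/-- Integration by parts exchanging the two Wirtinger derivatives. -/
lemma integral_dz_mul_dzbar {f g : ℂ → ℂ} (hf : ContDiff ℝ (⊤ : ℕ∞) f)
    (hfc : HasCompactSupport f) (hg : ContDiff ℝ (⊤ : ℕ∞) g) :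
    ∫ z, dz f z * dzbar g z = ∫ z, dzbar f z * dz g z := by
  have hint : ∀ v w : ℂ, Integrable fun z => fderiv ℝ f z v * fderiv ℝ g z w := fun v w =>
    ((hf.fderiv_apply_smooth v).continuous.mul
      (hg.fderiv_apply_smooth w).continuous).integrable_of_hasCompactSupport
      (hfc.fderiv_apply ℝ v).mul_right
  have i1 : Integrable fun z => dz f z * dzbar g z :=
    (hf.dz.continuous.mul hg.dzbar.continuous).integrable_of_hasCompactSupport hfc.dz.mul_right
  have i2 : Integrable fun z => dzbar f z * dz g z :=
    (hf.dzbar.continuous.mul hg.dz.continuous).integrable_of_hasCompactSupport hfc.dzbar.mul_right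
  rw [← sub_eq_zero, ← integral_sub i1 i2]
  have : ∀ z, dz f z * dzbar g z - dzbar f z * dz g z =
      Complex.I / 2 * (fderiv ℝ f z 1 * fderiv ℝ g z Complex.I -
        fderiv ℝ f z Complex.I * fderiv ℝ g z 1) := by
    intro z
    simp only [dz, dzbar]
    ring
  simp_rw [this]
  rw [integral_const_mul, integral_sub (hint _ _) (hint _ _),
    integral_fderiv_mul_fderiv_comm hf hfc hg, sub_self, mul_zero]

lemma fderiv_conj_comp {f : ℂ → ℂ} {z : ℂ} (hf : DifferentiableAt ℝ f z) (v : ℂ) :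
    fderiv ℝ (fun y => (starRingEnd ℂ) (f y)) z v = (starRingEnd ℂ) (fderiv ℝ f z v) := by
  have := (Complex.conjCLE.hasFDerivAt.comp z hf.hasFDerivAt).fderiv
  have h2 : (fun y => (starRingEnd ℂ) (f y)) = Complex.conjCLE ∘ f := by
    ext; simp
  rw [h2, this]
  simp

/-- The Beurling transform is an `L²` isometry. -/
lemma integral_norm_dz_sq {f : ℂ → ℂ} (hf : ContDiff ℝ (⊤ : ℕ∞) f)
    (hfc : HasCompactSupport f) : ∫ z, ‖dz f z‖ ^ 2 = ∫ z, ‖dzbar f z‖ ^ 2 := by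
  have hd : Differentiable ℝ f := hf.differentiable (by simp)
  have h1 : ∀ z, dzbar (fun y => (starRingEnd ℂ) (f y)) z = (starRingEnd ℂ) (dz f z) := by
    intro z
    simp [dzbar, dz, fderiv_conj_comp (hd z), map_ofNat, sub_eq_add_neg]
  have h2 : ∀ z, dz (fun y => (starRingEnd ℂ) (f y)) z = (starRingEnd ℂ) (dzbar f z) := by
    intro z
    simp [dzbar, dz, fderiv_conj_comp (hd z), map_ofNat, sub_eq_add_neg]
  have hc : ContDiff ℝ (⊤ : ℕ∞) fun y => (starRingEnd ℂ) (f y) :=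
    Complex.conjCLE.contDiff.comp hf
  have h := integral_dz_mul_dzbar hf hfc hc
  simp_rw [h1, h2, Complex.mul_conj, Complex.normSq_eq_norm_sq, integral_complex_ofReal] at h
  exact_mod_cast h

lemma integrableOn_ball_norm_inv (r : ℝ) :
    IntegrableOn (fun w : ℂ => ‖w‖⁻¹) (Metric.ball 0 r) := by
  rw [integrableOn_fun_norm_addHaar volume (f := fun y : ℝ => y⁻¹)]
  have : IntegrableOn (fun _ : ℝ => (1 : ℝ)) (Set.Ioo 0 r) := by simp
  refine this.congr_fun (fun y hy => ?_) measurableSet_Ioo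
  have : y ≠ 0 := hy.1.ne'
  simp [Complex.finrank_real_complex, this]

lemma locallyIntegrable_complex_inv : LocallyIntegrable (fun w : ℂ => w⁻¹) := by
  intro z
  refine ⟨Metric.ball 0 (‖z‖ + 1), Metric.isOpen_ball.mem_nhds (by simp), ?_⟩
  refine (integrableOn_ball_norm_inv (‖z‖ + 1)).mono' (by fun_prop) (ae_of_all _ fun w => ?_)
  simp

lemma exists_setIntegral_norm_inv_cube_le : ∃ C > (0 : ℝ), ∀ ρ > (0 : ℝ),
    IntegrableOn (fun w : ℂ => (‖w‖ ^ 3)⁻¹) (Metric.ball 0 ρ)ᶜ ∧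
    ∫ w in (Metric.ball (0 : ℂ) ρ)ᶜ, (‖w‖ ^ 3)⁻¹ ≤ C / ρ := by
  set m : ℝ := volume.real (Metric.ball (0 : ℂ) 1)
  refine ⟨2 * m + 1, by positivity, fun ρ hρ => ?_⟩
  have hf : (Metric.ball (0 : ℂ) ρ)ᶜ.indicator (fun w : ℂ => (‖w‖ ^ 3)⁻¹) =
      fun w : ℂ => (Set.Ici ρ).indicator (fun y : ℝ => (y ^ 3)⁻¹) ‖w‖ := by
    ext w
    by_cases h : ρ ≤ ‖w‖ <;> simp [h]
  have hg : ∀ y ∈ Set.Ioi (0 : ℝ), y ^ (Module.finrank ℝ ℂ - 1) •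
      (Set.Ici ρ).indicator (fun y : ℝ => (y ^ 3)⁻¹) y =
      (Set.Ici ρ).indicator (fun y : ℝ => y ^ (-2 : ℝ)) y := by
    intro y hy
    have hy : 0 < y := hy
    by_cases h : ρ ≤ y
    · simp only [Complex.finrank_real_complex, Set.indicator_apply, Set.mem_Ici, h, if_true]
      rw [Real.rpow_neg hy.le]
      norm_num
      field_simp
    · simp [h]
  have hsub : Set.Ioi (0 : ℝ) ∩ Set.Ici ρ = Set.Ici ρ :=
    Set.inter_eq_right.2 fun y hy => hρ.trans_le hy
  constructor
  · rw [← integrable_indicator_iff Metric.isOpen_ball.measurableSet.compl, hf,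
      integrable_fun_norm_addHaar volume, integrableOn_congr_fun hg measurableSet_Ioi,
      IntegrableOn, integrable_indicator_iff measurableSet_Ici, IntegrableOn,
      Measure.restrict_restrict measurableSet_Ici, Set.inter_comm, hsub]
    exact (integrableOn_Ioi_rpow_of_lt (by norm_num) hρ).congr_set_ae Ioi_ae_eq_Ici.symm
  · rw [← integral_indicator Metric.isOpen_ball.measurableSet.compl, hf,
      integral_fun_norm_addHaar volume, setIntegral_congr_fun measurableSet_Ioi hg,
      setIntegral_indicator measurableSet_Ici, hsub, integral_Ici_eq_integral_Ioi,
      integral_Ioi_rpow_of_lt (by norm_num) hρ]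
    norm_num [Complex.finrank_real_complex, Real.rpow_neg hρ.le]
    change 2 * (m * ρ⁻¹) ≤ _
    rw [div_eq_mul_inv]
    nlinarith [inv_pos.2 hρ]

lemma hasDerivAt_polarDir (θ : ℝ) :
    HasDerivAt (fun θ : ℝ => (Real.cos θ + Real.sin θ * Complex.I : ℂ))
      (Complex.I * (Real.cos θ + Real.sin θ * Complex.I)) θ := by
  have h1 := (Real.hasDerivAt_cos θ).ofReal_comp
  have h2 := (Real.hasDerivAt_sin θ).ofReal_comp
  refine (h1.add (h2.mul_const Complex.I)).congr_deriv ?_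
  push_cast
  linear_combination (- Complex.sin θ) * Complex.I_sq

lemma integral_radial_deriv {f : ℂ → ℂ} (hf : ContDiff ℝ (⊤ : ℕ∞) f) (hfc : HasCompactSupport f)
    (z : ℂ) {e : ℂ} (he : ‖e‖ = 1) :
    ∫ r in Set.Ioi (0 : ℝ), fderiv ℝ f (z - r * e) e = f z := by
  have hd : ∀ r : ℝ, HasDerivAt (fun r : ℝ => f (z - r * e)) (-(fderiv ℝ f (z - r * e) e)) r := by
    intro r
    have h1 : HasDerivAt (fun r : ℝ => z - r * e) (-e) r := by
      simpa using ((Complex.ofRealCLM.hasDerivAt (x := r)).mul_const e).const_sub z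
    have := ((hf.differentiable (by simp)) (z - r * e)).hasFDerivAt.comp_hasDerivAt r h1
    rw [map_neg] at this
    exact this
  have hs : ContDiff ℝ 1 fun r : ℝ => f (z - r * e) := by
    have : ContDiff ℝ 1 fun r : ℝ => (r : ℂ) := Complex.ofRealCLM.contDiff
    exact (hf.of_le (by simp)).comp (contDiff_const.sub (this.mul contDiff_const))
  have hc : HasCompactSupport fun r : ℝ => f (z - r * e) := by
    obtain ⟨R, hR⟩ := hfc.isCompact.isBounded.subset_closedBall z
    refine HasCompactSupport.intro (isCompact_closedBall (0 : ℝ) R) fun r hr => ?_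
    by_contra h
    have := hR (subset_tsupport f h)
    simp [he] at this hr
    linarith
  have := hc.integral_Ioi_deriv_eq hs 0
  simp_rw [fun r => (hd r).deriv, integral_neg] at this
  simpa using neg_injective this

lemma integral_angular_deriv {f : ℂ → ℂ} (hf : ContDiff ℝ (⊤ : ℕ∞) f) (z : ℂ) {r : ℝ}
    (hr : 0 < r) :
    ∫ θ in Set.Ioo (-Real.pi) Real.pi, fderiv ℝ f
      (z - r * (Real.cos θ + Real.sin θ * Complex.I))
      (Complex.I * (Real.cos θ + Real.sin θ * Complex.I)) = 0 := by
  have hd : ∀ θ : ℝ, HasDerivAt (fun θ : ℝ => f (z - r * (Real.cos θ + Real.sin θ * Complex.I)))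
      (-(r * fderiv ℝ f (z - r * (Real.cos θ + Real.sin θ * Complex.I))
        (Complex.I * (Real.cos θ + Real.sin θ * Complex.I)))) θ := by
    intro θ
    have h1 := ((hasDerivAt_polarDir θ).const_mul (r : ℂ)).const_sub z
    have := ((hf.differentiable (by simp)) _).hasFDerivAt.comp_hasDerivAt θ h1
    refine this.congr_deriv ?_
    rw [map_neg, ← Complex.real_smul (x := r) (z := Complex.I * _), map_smul, Complex.real_smul]
  have hcont : Continuous fun θ : ℝ => fderiv ℝ f
      (z - r * (Real.cos θ + Real.sin θ * Complex.I))
      (Complex.I * (Real.cos θ + Real.sin θ * Complex.I)) := by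
    refine ((hf.continuous_fderiv (by simp)).comp ?_).clm_apply ?_ <;> fun_prop
  have h := intervalIntegral.integral_eq_sub_of_hasDerivAt (a := -Real.pi) (b := Real.pi)
    (fun θ _ => hd θ) ((continuous_const.mul hcont).neg.intervalIntegrable _ _)
  rw [intervalIntegral.integral_of_le (by linarith [Real.pi_pos]), integral_Ioc_eq_integral_Ioo,
    integral_neg, integral_const_mul] at h
  have hr' : (r : ℂ) ≠ 0 := by exact_mod_cast hr.ne'
  simpa [hr'] using h

/-- The Cauchy–Pompeiu formula for compactly supported functions. -/
lemma integral_inv_mul_dzbar {f : ℂ → ℂ} (hf : ContDiff ℝ (⊤ : ℕ∞) f)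
    (hfc : HasCompactSupport f) (z : ℂ) : ∫ w, w⁻¹ * dzbar f (z - w) = Real.pi * f z := by
  rw [← Complex.integral_comp_polarCoord_symm]
  set e : ℝ → ℂ := fun θ => Real.cos θ + Real.sin θ * Complex.I with he
  have hec : Continuous e := by fun_prop
  have hen : ∀ θ, ‖e θ‖ = 1 := fun θ => by
    simp only [he]
    push_cast
    rw [← Complex.exp_mul_I, Complex.norm_exp_ofReal_mul_I]
  set A : ℝ × ℝ → ℂ := fun p => fderiv ℝ f (z - p.1 * e p.2) (e p.2) with hA
  set B : ℝ × ℝ → ℂ := fun p => fderiv ℝ f (z - p.1 * e p.2) (Complex.I * e p.2) with hB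
  have hint : ∀ v : ℝ → ℂ, Continuous v → IntegrableOn
      (fun p : ℝ × ℝ => fderiv ℝ f (z - p.1 * e p.2) (v p.2))
      (Set.Ioi (0 : ℝ) ×ˢ Set.Ioo (-Real.pi) Real.pi) := by
    intro v hv
    have hcont : Continuous fun p : ℝ × ℝ => fderiv ℝ f (z - p.1 * e p.2) (v p.2) := by
      refine ((hf.continuous_fderiv (by simp)).comp ?_).clm_apply ?_ <;> fun_prop
    obtain ⟨R, hR⟩ := hfc.isCompact.isBounded.subset_closedBall z
    have h1 : IntegrableOn (fun p : ℝ × ℝ => fderiv ℝ f (z - p.1 * e p.2) (v p.2))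
        (Set.Icc 0 R ×ˢ Set.Icc (-Real.pi) Real.pi) :=
      hcont.continuousOn.integrableOn_compact (isCompact_Icc.prod isCompact_Icc)
    refine h1.of_forall_sdiff_eq_zero (measurableSet_Ioi.prod measurableSet_Ioo) ?_
    rintro ⟨r, θ⟩ ⟨⟨hr, hθ⟩, hn⟩
    have hr : 0 < r := hr
    have hrR : R < r := by
      by_contra h
      exact hn ⟨⟨hr.le, not_lt.1 h⟩, hθ.1.le, hθ.2.le⟩
    have : fderiv ℝ f (z - r * e θ) = 0 := by
      by_contra h
      have := hR (support_fderiv_subset ℝ h)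
      simp [hen, abs_of_pos hr] at this
      linarith
    simp [this]
  have hiA : IntegrableOn A (Set.Ioi (0 : ℝ) ×ˢ Set.Ioo (-Real.pi) Real.pi) := hint e hec
  have hiB : IntegrableOn B (Set.Ioi (0 : ℝ) ×ˢ Set.Ioo (-Real.pi) Real.pi) :=
    hint (fun θ => Complex.I * e θ) (by fun_prop)
  have hIA : ∫ p in Set.Ioi (0 : ℝ) ×ˢ Set.Ioo (-Real.pi) Real.pi, A p = 2 * Real.pi * f z := by
    rw [Measure.volume_eq_prod, ← setIntegral_prod_swap,
      setIntegral_prod (fun p : ℝ × ℝ => A p.swap) hiA.swap]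
    have : ∀ θ : ℝ, ∫ r in Set.Ioi (0 : ℝ), A (Prod.swap (θ, r)) = f z := fun θ =>
      integral_radial_deriv hf hfc z (hen θ)
    simp_rw [this]
    simp only [integral_const, measureReal_restrict_apply_univ, Real.volume_real_Ioo,
      Complex.real_smul]
    rw [max_eq_left (by linarith [Real.pi_pos])]
    push_cast
    ring
  have hIB : ∫ p in Set.Ioi (0 : ℝ) ×ˢ Set.Ioo (-Real.pi) Real.pi, B p = 0 := by
    rw [Measure.volume_eq_prod, setIntegral_prod _ hiB]
    rw [setIntegral_congr_fun measurableSet_Ioi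
      (fun r (hr : 0 < r) => integral_angular_deriv hf z hr)]
    simp
  have hcongr : ∀ p ∈ Set.Ioi (0 : ℝ) ×ˢ Set.Ioo (-Real.pi) Real.pi,
      p.1 • ((Complex.polarCoord.symm p)⁻¹ * dzbar f (z - Complex.polarCoord.symm p)) =
      (1 / 2) * A p + (Complex.I / 2) * B p := by
    rintro ⟨r, θ⟩ ⟨hr, -⟩
    have hr : (r : ℂ) ≠ 0 := by exact_mod_cast (ne_of_gt hr)
    have he0 : e θ ≠ 0 := by
      intro h
      simpa [h] using hen θ
    rw [Complex.polarCoord_symm_apply]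
    change r • ((r * e θ)⁻¹ * dzbar f (z - r * e θ)) = _
    have hlin : ∀ L : ℂ →L[ℝ] ℂ, L (e θ) + Complex.I * L (Complex.I * e θ) =
        (e θ)⁻¹ * (L 1 + Complex.I * L Complex.I) := by
      intro L
      have h1 : e θ = Real.cos θ • (1 : ℂ) + Real.sin θ • Complex.I := by simp [he]
      have h2 : Complex.I * e θ = Real.cos θ • Complex.I - Real.sin θ • (1 : ℂ) := by
        simp only [he, Complex.real_smul]
        linear_combination (Real.sin θ : ℂ) * Complex.I_sq
      have h3 : (e θ)⁻¹ = Real.cos θ - Real.sin θ * Complex.I := by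
        have h4 : (Real.sin θ : ℂ) ^ 2 + (Real.cos θ : ℂ) ^ 2 = 1 := by
          exact_mod_cast Real.sin_sq_add_cos_sq θ
        refine inv_eq_of_mul_eq_one_right ?_
        simp only [he]
        linear_combination h4 - (Real.sin θ : ℂ) ^ 2 * Complex.I_sq
      rw [h2, h3]
      conv_lhs => rw [h1]
      rw [map_add, map_sub, map_smul, map_smul, map_smul, map_smul]
      simp only [Complex.real_smul]
      linear_combination ((Real.sin θ : ℂ) * L Complex.I) * Complex.I_sq
    have := hlin (fderiv ℝ f (z - r * e θ))
    simp only [dzbar, hA, hB, Complex.real_smul]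
    rw [mul_inv, ← mul_assoc, ← mul_assoc, mul_inv_cancel₀ hr, one_mul]
    linear_combination (-1 / 2 : ℂ) * this
  rw [polarCoord_target, setIntegral_congr_fun (measurableSet_Ioi.prod measurableSet_Ioo)
    hcongr, integral_add (hiA.const_mul _) (hiB.const_mul _), integral_const_mul,
    integral_const_mul, hIA, hIB]
  ring

/-- The Cauchy transform `f ↦ (π z)⁻¹ ⋆ f`. -/
noncomputable def cauchyTransform (f : ℂ → ℂ) (z : ℂ) : ℂ :=
  (Real.pi : ℂ)⁻¹ * ∫ w, w⁻¹ * f (z - w)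

lemma integrable_inv_mul_comp_sub {f : ℂ → ℂ} (hf : Continuous f) (hfc : HasCompactSupport f)
    (z : ℂ) : Integrable fun w : ℂ => w⁻¹ * f (z - w) :=
  hfc.convolutionExists_right (ContinuousLinearMap.mul ℝ ℂ) locallyIntegrable_complex_inv hf z

lemma ContDiff.cauchyTransform {f : ℂ → ℂ} (hf : ContDiff ℝ (⊤ : ℕ∞) f)
    (hfc : HasCompactSupport f) : ContDiff ℝ (⊤ : ℕ∞) (cauchyTransform f) :=
  contDiff_const.mul (hfc.contDiff_convolution_right (ContinuousLinearMap.mul ℝ ℂ)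
    locallyIntegrable_complex_inv hf)

lemma fderiv_cauchyTransform {f : ℂ → ℂ} (hf : ContDiff ℝ (⊤ : ℕ∞) f)
    (hfc : HasCompactSupport f) (z v : ℂ) : fderiv ℝ (cauchyTransform f) z v =
      (Real.pi : ℂ)⁻¹ * ∫ w, w⁻¹ * fderiv ℝ f (z - w) v := by
  have h := (hfc.hasFDerivAt_convolution_right (ContinuousLinearMap.mul ℝ ℂ)
    locallyIntegrable_complex_inv (hf.of_le (by simp)) z).const_mul (Real.pi : ℂ)⁻¹
  have h' : fderiv ℝ (cauchyTransform f) z = _ := h.fderiv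
  rw [h']
  have hi : Integrable fun w : ℂ => (ContinuousLinearMap.precompR ℂ
      (ContinuousLinearMap.mul ℝ ℂ)) w⁻¹ (fderiv ℝ f (z - w)) :=
    (hfc.fderiv ℝ).convolutionExists_right _ locallyIntegrable_complex_inv
      (hf.continuous_fderiv (by simp)) z
  simp only [_root_.smul_apply, convolution_def, smul_eq_mul]
  rw [ContinuousLinearMap.integral_apply hi]
  simp

lemma dzbar_cauchyTransform {f : ℂ → ℂ} (hf : ContDiff ℝ (⊤ : ℕ∞) f)
    (hfc : HasCompactSupport f) (z : ℂ) : dzbar (cauchyTransform f) z = f z := by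
  have hi : ∀ v, Integrable fun w : ℂ => w⁻¹ * fderiv ℝ f (z - w) v := fun v =>
    integrable_inv_mul_comp_sub (hf.fderiv_apply_smooth v).continuous (hfc.fderiv_apply ℝ v) z
  have h := integral_inv_mul_dzbar hf hfc z
  have h2 : ∫ w, w⁻¹ * dzbar f (z - w) = ((∫ w, w⁻¹ * fderiv ℝ f (z - w) 1) +
      Complex.I * ∫ w, w⁻¹ * fderiv ℝ f (z - w) Complex.I) / 2 := by
    rw [← integral_const_mul, ← integral_add (hi 1) ((hi Complex.I).const_mul _),
      ← integral_div]
    refine integral_congr_ae (ae_of_all _ fun w => ?_)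
    simp only [dzbar]
    ring
  rw [dzbar, fderiv_cauchyTransform hf hfc, fderiv_cauchyTransform hf hfc]
  rw [h2] at h
  have hpi : (Real.pi : ℂ) ≠ 0 := by exact_mod_cast Real.pi_ne_zero
  rw [← inv_mul_cancel_left₀ hpi (f z), ← h]
  ring

lemma exists_norm_cauchyTransform_le : ∃ M > (0 : ℝ), ∀ f : ℂ → ℂ, ContDiff ℝ (⊤ : ℕ∞) f →
    HasCompactSupport f → (∀ z, ‖f z‖ ≤ 1) → tsupport f ⊆ Metric.ball 0 2 →
    ∀ z ∈ Metric.closedBall (0 : ℂ) 4, ‖cauchyTransform f z‖ ≤ M := by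
  refine ⟨Real.pi⁻¹ * (∫ w in Metric.ball (0 : ℂ) 6, ‖w‖⁻¹) + 1, ?_, ?_⟩
  · have : 0 ≤ ∫ w in Metric.ball (0 : ℂ) 6, ‖w‖⁻¹ :=
      setIntegral_nonneg Metric.isOpen_ball.measurableSet fun w _ => by positivity
    positivity
  intro f hf hfc hb hs z hz
  have hz : ‖z‖ ≤ 4 := by simpa using hz
  have h : ‖∫ w, w⁻¹ * f (z - w)‖ ≤ ∫ w in Metric.ball (0 : ℂ) 6, ‖w‖⁻¹ := by
    rw [← integral_indicator Metric.isOpen_ball.measurableSet]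
    refine norm_integral_le_of_norm_le ((integrableOn_ball_norm_inv 6).integrable_indicator
      Metric.isOpen_ball.measurableSet) (ae_of_all _ fun w => ?_)
    by_cases hw : f (z - w) = 0
    · simp only [hw, mul_zero, norm_zero]
      exact Set.indicator_nonneg (fun _ _ => by positivity) _
    · have h1 : ‖z - w‖ < 2 := by simpa using hs (subset_tsupport f hw)
      have h2 : ‖w‖ < 6 := by
        have := norm_sub_le z (z - w)
        rw [sub_sub_cancel] at this
        linarith
      rw [Set.indicator_of_mem (by simpa using h2), norm_mul, norm_inv]
      exact mul_le_of_le_one_right (by positivity) (hb _)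
  rw [cauchyTransform, norm_mul, norm_inv, Complex.norm_real, Real.norm_eq_abs,
    abs_of_pos Real.pi_pos]
  have := mul_le_mul_of_nonneg_left h (inv_nonneg.2 Real.pi_pos.le)
  linarith

lemma dzbar_mul {f g : ℂ → ℂ} {z : ℂ} (hf : DifferentiableAt ℝ f z)
    (hg : DifferentiableAt ℝ g z) :
    dzbar (fun y => f y * g y) z = f z * dzbar g z + dzbar f z * g z := by
  have : fderiv ℝ (fun y => f y * g y) z = f z • fderiv ℝ g z + g z • fderiv ℝ f z :=
    fderiv_fun_mul hf hg
  simp only [dzbar, this]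
  simp
  ring

/-- Local `L²` bound for the Beurling transform of a bounded function. -/
lemma exists_setIntegral_norm_dz_cauchyTransform_sq_le : ∃ A > (0 : ℝ), ∀ f : ℂ → ℂ,
    ContDiff ℝ (⊤ : ℕ∞) f → HasCompactSupport f → (∀ z, ‖f z‖ ≤ 1) →
    tsupport f ⊆ Metric.ball 0 2 →
    ∫ z in Metric.ball (0 : ℂ) 2, ‖dz (cauchyTransform f) z‖ ^ 2 ≤ A := by
  obtain ⟨M, hM, hMf⟩ := exists_norm_cauchyTransform_le
  let χ : ContDiffBump (0 : ℂ) := ⟨2, 4, by norm_num, by norm_num⟩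
  let X : ℂ → ℂ := fun z => (χ z : ℂ)
  have hX : ContDiff ℝ (⊤ : ℕ∞) X := Complex.ofRealCLM.contDiff.comp χ.contDiff
  have hX0 : ∀ z ∉ Metric.ball (0 : ℂ) 4, X z = 0 := fun z hz => by
    have : χ z = 0 := χ.zero_of_le_dist (by simpa using hz)
    simp [X, this]
  have hXs : tsupport X ⊆ Metric.closedBall 0 4 := by
    refine closure_minimal (fun z hz => ?_) Metric.isClosed_closedBall
    by_contra h
    exact hz (hX0 z fun h' => h (Metric.ball_subset_closedBall h'))
  have hXc : HasCompactSupport X :=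
    HasCompactSupport.of_support_subset_isCompact (isCompact_closedBall _ _)
      ((subset_tsupport X).trans hXs)
  obtain ⟨D, hD⟩ := hXc.dzbar.exists_bound_of_continuous hX.dzbar.continuous
  have hD0 : 0 ≤ D := (norm_nonneg _).trans (hD 0)
  set m : ℝ := volume.real (Metric.closedBall (0 : ℂ) 4) with hm
  refine ⟨(1 + D * M) ^ 2 * m + 1, by positivity, fun f hf hfc hb hs => ?_⟩
  set Ψ := cauchyTransform f with hΨ
  have hΨs : ContDiff ℝ (⊤ : ℕ∞) Ψ := hf.cauchyTransform hfc
  set h : ℂ → ℂ := fun z => X z * Ψ z with hh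
  have hhs : ContDiff ℝ (⊤ : ℕ∞) h := hX.mul hΨs
  have hhc : HasCompactSupport h := hXc.mul_right
  have h1 : ∀ z ∈ Metric.ball (0 : ℂ) 2, dz Ψ z = dz h z := by
    intro z hz
    have : h =ᶠ[nhds z] Ψ := by
      filter_upwards [Metric.isOpen_ball.mem_nhds hz] with y hy
      have : χ y = 1 := χ.one_of_mem_closedBall (Metric.ball_subset_closedBall hy)
      simp [hh, X, this]
    simp only [dz, this.fderiv_eq]
  have h2 : ∀ z, ‖dzbar h z‖ ^ 2 ≤
      (Metric.closedBall (0 : ℂ) 4).indicator (fun _ => (1 + D * M) ^ 2) z := by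
    intro z
    by_cases hz : z ∈ Metric.closedBall (0 : ℂ) 4
    · rw [Set.indicator_of_mem hz, hh, dzbar_mul (hX.differentiable (by simp) z)
        (hΨs.differentiable (by simp) z), hΨ, dzbar_cauchyTransform hf hfc]
      have hX1 : ‖X z‖ ≤ 1 := by
        simp only [X, Complex.norm_real, Real.norm_eq_abs, abs_of_nonneg χ.nonneg]
        exact χ.le_one
      have h3 : ‖X z * f z‖ ≤ 1 := by
        rw [norm_mul]
        exact mul_le_one₀ hX1 (norm_nonneg _) (hb z)
      have h4 : ‖dzbar X z * cauchyTransform f z‖ ≤ D * M := by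
        rw [norm_mul]
        exact mul_le_mul (hD z) (hMf f hf hfc hb hs z hz) (norm_nonneg _) hD0
      have h5 := (norm_add_le _ _).trans (add_le_add h3 h4)
      gcongr
    · have : dzbar h z = 0 := dzbar_eq_zero_of_notMem_tsupport fun h' =>
        hz (hXs (closure_mono (Function.support_mul_subset_left X Ψ) h'))
      simp [this, hz]
  have hint : Integrable fun z => ‖dz h z‖ ^ 2 := by
    have hc : Continuous fun z => ‖dz h z‖ ^ 2 := hhs.dz.continuous.norm.pow 2
    refine hc.integrable_of_hasCompactSupport (HasCompactSupport.intro hhc.dz.isCompact ?_)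
    intro z hz
    simp [image_eq_zero_of_notMem_tsupport hz]
  calc ∫ z in Metric.ball (0 : ℂ) 2, ‖dz Ψ z‖ ^ 2
      = ∫ z in Metric.ball (0 : ℂ) 2, ‖dz h z‖ ^ 2 :=
        setIntegral_congr_fun Metric.isOpen_ball.measurableSet fun z hz => by
          simp only [h1 z hz]
    _ ≤ ∫ z, ‖dz h z‖ ^ 2 := by
        exact setIntegral_le_integral hint (ae_of_all _ fun z => by positivity)
    _ = ∫ z, ‖dzbar h z‖ ^ 2 := integral_norm_dz_sq hhs hhc
    _ ≤ ∫ z, (Metric.closedBall (0 : ℂ) 4).indicator (fun _ => (1 + D * M) ^ 2) z := by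
        refine integral_mono_of_nonneg (ae_of_all _ fun z => by positivity) ?_ (ae_of_all _ h2)
        exact IntegrableOn.integrable_indicator
          (integrableOn_const (isCompact_closedBall _ _).measure_lt_top.ne)
          Metric.isClosed_closedBall.measurableSet
    _ = (1 + D * M) ^ 2 * m := by
        rw [integral_indicator Metric.isClosed_closedBall.measurableSet, setIntegral_const,
          smul_eq_mul, mul_comm]
    _ ≤ _ := by linarith

lemma hasDerivAt_cauchyTransform {f : ℂ → ℂ} (hf : Continuous f) (hfc : HasCompactSupport f)
    {z : ℂ} {ρ : ℝ} (hρ : 0 < ρ) (h0 : ∀ w ∈ Metric.ball z ρ, f w = 0) :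
    HasDerivAt (cauchyTransform f) ((Real.pi : ℂ)⁻¹ * ∫ w, -(f w * ((z - w) ^ 2)⁻¹)) z ∧
      Integrable fun w => f w * ((z - w) ^ 2)⁻¹ := by
  have hC : cauchyTransform f = fun x => (Real.pi : ℂ)⁻¹ * ∫ w, f w * (x - w)⁻¹ := by
    ext x
    rw [cauchyTransform, ← integral_sub_left_eq_self (fun w => f w * (x - w)⁻¹) volume x]
    congr 2
    ext w
    rw [sub_sub_cancel, mul_comm]
  have hfar : ∀ w, f w ≠ 0 → ∀ x ∈ Metric.ball z (ρ / 2), ρ / 2 ≤ ‖x - w‖ := by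
    intro w hw x hx
    have h1 : ρ ≤ dist w z := by
      by_contra h
      exact hw (h0 w (not_le.1 h))
    have h2 : dist x z < ρ / 2 := hx
    have h3 := dist_triangle w x z
    rw [← dist_eq_norm, dist_comm]
    linarith
  have key := hasDerivAt_integral_of_dominated_loc_of_deriv_le (μ := volume) (𝕜 := ℂ)
    (F := fun x w => f w * (x - w)⁻¹) (F' := fun x w => -(f w * ((x - w) ^ 2)⁻¹)) (x₀ := z)
    (s := Metric.ball z (ρ / 2)) (bound := fun w => ‖f w‖ * ((ρ / 2) ^ 2)⁻¹)
    (Metric.ball_mem_nhds z (by positivity)) ?_ ?_ ?_ ?_ ?_ ?_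
  · rw [hC]
    exact ⟨key.2.const_mul _, by simpa using key.1.neg⟩
  · refine Filter.Eventually.of_forall fun x => Measurable.aestronglyMeasurable ?_
    have := hf.measurable
    fun_prop
  · have := (integrable_inv_mul_comp_sub hf hfc z).comp_sub_left z
    simpa [mul_comm] using this
  · refine Measurable.aestronglyMeasurable ?_
    have := hf.measurable
    fun_prop
  · refine ae_of_all _ fun w x hx => ?_
    by_cases hw : f w = 0
    · simp [hw]
    · have := hfar w hw x hx
      rw [norm_neg, norm_mul, norm_inv, norm_pow]
      gcongr
  · exact (hf.norm.integrable_of_hasCompactSupport hfc.norm).mul_const _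
  · refine ae_of_all _ fun w x hx => ?_
    by_cases hw : f w = 0
    · simp [hw, hasDerivAt_const]
    · have h1 := hfar w hw x hx
      have h2 : x - w ≠ 0 := by
        rw [← norm_pos_iff]
        linarith
      have := (((hasDerivAt_id x).sub_const w).fun_inv h2).const_mul (f w)
      simpa [div_eq_mul_inv] using this

lemma dz_eq_of_hasDerivAt {f : ℂ → ℂ} {z d : ℂ} (h : HasDerivAt f d z) : dz f z = d := by
  have := (h.hasFDerivAt.restrictScalars ℝ).fderiv
  simp only [dz, this]
  simp
  linear_combination (-d / 2) * Complex.I_sq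

/-- The Beurling transform of a bounded function vanishing on a ball has bounded oscillation
on the concentric ball of half the radius. -/
lemma exists_norm_dz_cauchyTransform_sub_le : ∃ C > (0 : ℝ), ∀ f : ℂ → ℂ, Continuous f →
    HasCompactSupport f → (∀ z, ‖f z‖ ≤ 1) → ∀ (c : ℂ) (ρ : ℝ), 0 < ρ →
    (∀ w ∈ Metric.closedBall c (2 * ρ), f w = 0) → ∀ z ∈ Metric.closedBall c ρ,
    ‖dz (cauchyTransform f) z - dz (cauchyTransform f) c‖ ≤ C := by
  obtain ⟨C, hC, hCρ⟩ := exists_setIntegral_norm_inv_cube_le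
  refine ⟨Real.pi⁻¹ * (5 * C), by positivity, fun f hf hfc hb c ρ hρ h0 z hz => ?_⟩
  have hz : ‖z - c‖ ≤ ρ := by simpa [dist_eq_norm] using hz
  obtain ⟨hz1, hz2⟩ := hasDerivAt_cauchyTransform hf hfc hρ (z := z) fun w hw => h0 w (by
    have hw : ‖w - z‖ < ρ := by simpa [dist_eq_norm] using hw
    have := norm_add_le (w - z) (z - c)
    rw [sub_add_sub_cancel] at this
    simp only [Metric.mem_closedBall, dist_eq_norm]
    linarith)
  obtain ⟨hc1, hc2⟩ := hasDerivAt_cauchyTransform hf hfc hρ (z := c) fun w hw => h0 w (by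
    have hw : ‖w - c‖ < ρ := by simpa [dist_eq_norm] using hw
    simp only [Metric.mem_closedBall, dist_eq_norm]
    linarith)
  obtain ⟨hi, hint⟩ := hCρ (2 * ρ) (by positivity)
  rw [dz_eq_of_hasDerivAt hz1, dz_eq_of_hasDerivAt hc1, ← mul_sub,
    ← integral_sub (f := fun w => -(f w * ((z - w) ^ 2)⁻¹))
      (g := fun w => -(f w * ((c - w) ^ 2)⁻¹)) hz2.neg hc2.neg,
    norm_mul, norm_inv, Complex.norm_real, Real.norm_eq_abs, abs_of_pos Real.pi_pos]
  refine mul_le_mul_of_nonneg_left ?_ (inv_nonneg.2 Real.pi_pos.le)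
  have hm : MeasurableSet (Metric.ball (0 : ℂ) (2 * ρ))ᶜ := Metric.isOpen_ball.measurableSet.compl
  set b : ℂ → ℝ := (Metric.ball (0 : ℂ) (2 * ρ))ᶜ.indicator fun w => (‖w‖ ^ 3)⁻¹ with hb'
  have hbi : Integrable b := hi.integrable_indicator hm
  have hbnd : ∀ w, ‖-(f w * ((z - w) ^ 2)⁻¹) - -(f w * ((c - w) ^ 2)⁻¹)‖ ≤
      10 * ρ * b (w - c) := by
    intro w
    by_cases hw : f w = 0
    · simp only [hw, zero_mul, neg_zero, sub_zero, norm_zero]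
      have : 0 ≤ b (w - c) := Set.indicator_nonneg (fun _ _ => by positivity) _
      positivity
    have hu : 2 * ρ < ‖w - c‖ := by
      by_contra h
      exact hw (h0 w (by simpa [dist_eq_norm] using h))
    have hbw : b (w - c) = (‖w - c‖ ^ 3)⁻¹ := by
      rw [hb', Set.indicator_of_mem]
      simpa using hu.le
    set u := ‖w - c‖
    have hzw : u / 2 ≤ ‖z - w‖ := by
      have := norm_sub_le (z - c) (z - w)
      rw [sub_sub_sub_cancel_left] at this
      linarith
    have hcw : ‖c - w‖ = u := norm_sub_rev _ _
    have hsum : ‖z + c - 2 * w‖ ≤ 5 / 2 * u := by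
      have : z + c - 2 * w = (z - c) - 2 * (w - c) := by ring
      rw [this]
      refine (norm_sub_le _ _).trans ?_
      rw [norm_mul]
      simp only [Complex.norm_ofNat]
      change _ + 2 * u ≤ _
      linarith
    have hu0 : 0 < u := by linarith
    have hzw0 : z - w ≠ 0 := norm_pos_iff.1 (by linarith)
    have hcw0 : c - w ≠ 0 := norm_pos_iff.1 (by linarith)
    have heq : -(f w * ((z - w) ^ 2)⁻¹) - -(f w * ((c - w) ^ 2)⁻¹) =
        f w * ((z - c) * (z + c - 2 * w) * (((z - w) ^ 2)⁻¹ * ((c - w) ^ 2)⁻¹)) := by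
      field_simp
      ring
    rw [heq, norm_mul, norm_mul, norm_mul, norm_mul, norm_inv, norm_inv, norm_pow, norm_pow, hbw,
      hcw]
    calc ‖f w‖ * (‖z - c‖ * ‖z + c - 2 * w‖ * ((‖z - w‖ ^ 2)⁻¹ * (u ^ 2)⁻¹))
        ≤ 1 * (ρ * (5 / 2 * u) * (((u / 2) ^ 2)⁻¹ * (u ^ 2)⁻¹)) := by
          gcongr
          exact hb w
      _ = 10 * ρ * (u ^ 3)⁻¹ := by
          field_simp
          norm_num
  refine (norm_integral_le_of_norm_le ((hbi.comp_sub_right c).const_mul (10 * ρ))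
    (ae_of_all _ hbnd)).trans ?_
  rw [integral_const_mul, integral_sub_right_eq_self (fun w => b w), hb', integral_indicator hm]
  calc 10 * ρ * ∫ w in (Metric.ball (0 : ℂ) (2 * ρ))ᶜ, (‖w‖ ^ 3)⁻¹
      ≤ 10 * ρ * (C / (2 * ρ)) := by gcongr
    _ = 5 * C := by
        field_simp
        norm_num

/-- The half-open square with lower left corner `c` and side `s`. -/
def halfOpenSquare (c : ℂ) (s : ℝ) : Set ℂ :=
  Set.Ico c.re (c.re + s) ×ℂ Set.Ico c.im (c.im + s)

lemma measurableSet_Ico_reProdIm_Ico (a b c d : ℝ) :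
    MeasurableSet (Set.Ico a b ×ℂ Set.Ico c d) :=
  (Complex.measurable_re measurableSet_Ico).inter (Complex.measurable_im measurableSet_Ico)

lemma measurableSet_halfOpenSquare (c : ℂ) (s : ℝ) : MeasurableSet (halfOpenSquare c s) :=
  measurableSet_Ico_reProdIm_Ico ..

lemma Continuous.integrableOn_Ico_reProdIm_Ico {E : Type*} [NormedAddCommGroup E] {h : ℂ → E}
    (hh : Continuous h) (a b c d : ℝ) : IntegrableOn h (Set.Ico a b ×ℂ Set.Ico c d) :=
  (hh.continuousOn.integrableOn_compact (isCompact_Icc.reProdIm isCompact_Icc)).mono_set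
    (Set.inter_subset_inter (Set.preimage_mono Set.Ico_subset_Icc_self)
      (Set.preimage_mono Set.Ico_subset_Icc_self))

lemma Continuous.integrableOn_halfOpenSquare {E : Type*} [NormedAddCommGroup E] {h : ℂ → E}
    (hh : Continuous h) (c : ℂ) (s : ℝ) : IntegrableOn h (halfOpenSquare c s) :=
  hh.integrableOn_Ico_reProdIm_Ico ..

lemma volume_real_halfOpenSquare (c : ℂ) {s : ℝ} (hs : 0 ≤ s) :
    volume.real (halfOpenSquare c s) = s ^ 2 := by
  have h := Complex.volume_preserving_equiv_real_prod.measure_preimage_equiv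
    (Set.Ico c.re (c.re + s) ×ˢ Set.Ico c.im (c.im + s))
  rw [Measure.volume_eq_prod, Measure.prod_prod, Real.volume_Ico, Real.volume_Ico] at h
  rw [measureReal_def, show halfOpenSquare c s = Complex.measurableEquivRealProd ⁻¹'
    (Set.Ico c.re (c.re + s) ×ˢ Set.Ico c.im (c.im + s)) from rfl, h]
  simp [hs, pow_two]

lemma norm_sub_le_of_mem_halfOpenSquare {c z w : ℂ} {s : ℝ} (hz : z ∈ halfOpenSquare c s)
    (hw : w ∈ halfOpenSquare c s) : ‖z - w‖ ≤ 2 * s := by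
  obtain ⟨⟨h1, h2⟩, h3, h4⟩ := hz
  obtain ⟨⟨h5, h6⟩, h7, h8⟩ := hw
  refine (Complex.norm_le_abs_re_add_abs_im _).trans ?_
  have h9 : |(z - w).re| ≤ s := by
    rw [Complex.sub_re, abs_le]
    constructor <;> linarith
  have h10 : |(z - w).im| ≤ s := by
    rw [Complex.sub_im, abs_le]
    constructor <;> linarith
  linarith

lemma self_mem_halfOpenSquare {c : ℂ} {s : ℝ} (hs : 0 < s) : c ∈ halfOpenSquare c s := by
  simp [halfOpenSquare, Complex.mem_reProdIm, hs]

lemma Ico_reProdIm_union {a b m : ℝ} (t : Set ℝ) (h1 : a ≤ m) (h2 : m ≤ b) :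
    Set.Ico a b ×ℂ t = Set.Ico a m ×ℂ t ∪ Set.Ico m b ×ℂ t := by
  ext z
  simp only [Complex.mem_reProdIm, Set.mem_union, ← Set.Ico_union_Ico_eq_Ico h1 h2]
  tauto

lemma reProdIm_Ico_union {a b m : ℝ} (t : Set ℝ) (h1 : a ≤ m) (h2 : m ≤ b) :
    t ×ℂ Set.Ico a b = t ×ℂ Set.Ico a m ∪ t ×ℂ Set.Ico m b := by
  ext z
  simp only [Complex.mem_reProdIm, Set.mem_union, ← Set.Ico_union_Ico_eq_Ico h1 h2]
  tauto

/-- The integral over a square is the sum of the integrals over its four quarters. -/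
lemma setIntegral_halfOpenSquare_eq {E : Type*} [NormedAddCommGroup E] [NormedSpace ℝ E]
    {h : ℂ → E} (hh : Continuous h) (c : ℂ) {s : ℝ} (hs : 0 ≤ s) :
    ∫ z in halfOpenSquare c s, h z =
      (∫ z in halfOpenSquare c (s / 2), h z) +
      (∫ z in halfOpenSquare ⟨c.re, c.im + s / 2⟩ (s / 2), h z) +
      ((∫ z in halfOpenSquare ⟨c.re + s / 2, c.im⟩ (s / 2), h z) +
      (∫ z in halfOpenSquare ⟨c.re + s / 2, c.im + s / 2⟩ (s / 2), h z)) := by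
  have hv : ∀ a b : ℝ, ∫ z in Set.Ico a b ×ℂ Set.Ico c.im (c.im + s), h z =
      (∫ z in Set.Ico a b ×ℂ Set.Ico c.im (c.im + s / 2), h z) +
      ∫ z in Set.Ico a b ×ℂ Set.Ico (c.im + s / 2) (c.im + s), h z := by
    intro a b
    rw [reProdIm_Ico_union (m := c.im + s / 2) _ (by linarith) (by linarith)]
    refine setIntegral_union ?_ (measurableSet_Ico_reProdIm_Ico ..)
      (hh.integrableOn_Ico_reProdIm_Ico ..) (hh.integrableOn_Ico_reProdIm_Ico ..)
    rw [Set.disjoint_left]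
    rintro z ⟨-, -, h1⟩ ⟨-, h2, -⟩
    linarith
  simp only [halfOpenSquare, add_assoc, add_halves]
  rw [Ico_reProdIm_union (m := c.re + s / 2) _ (by linarith) (by linarith), setIntegral_union _
    (measurableSet_Ico_reProdIm_Ico ..) (hh.integrableOn_Ico_reProdIm_Ico ..)
    (hh.integrableOn_Ico_reProdIm_Ico ..), hv, hv, add_assoc]
  rw [Set.disjoint_left]
  rintro z ⟨⟨-, h1⟩, -⟩ ⟨⟨h2, -⟩, -⟩
  linarith

/-- The outcome of stopping the dyadic subdivision of a square at the first squares on which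
the mean of `‖m‖` exceeds `1`. -/
structure IsCalderonZygmundFamily (m : ℂ → ℂ) (c : ℂ) (s : ℝ) (L : List (ℂ × ℝ)) : Prop where
  pos : ∀ q ∈ L, 0 < q.2
  sq_le : ∀ q ∈ L, q.2 ^ 2 ≤ ∫ z in halfOpenSquare q.1 q.2, ‖m z‖
  le_sq : ∀ q ∈ L, ∫ z in halfOpenSquare q.1 q.2, ‖m z‖ ≤ 4 * q.2 ^ 2
  norm_integral_le : ∀ h : ℂ → ℂ, Continuous h → ‖∫ z in halfOpenSquare c s, m z * h z‖ ≤
    (L.map fun q => ‖∫ z in halfOpenSquare q.1 q.2, m z * h z‖).sum +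
      ∫ z in halfOpenSquare c s, min ‖m z‖ 2 * ‖h z‖
  sum_le : ∀ h : ℂ → ℝ, Continuous h → (∀ z, 0 ≤ h z) →
    (L.map fun q => ∫ z in halfOpenSquare q.1 q.2, h z).sum ≤ ∫ z in halfOpenSquare c s, h z

lemma isCalderonZygmundFamily_nil {m : ℂ → ℂ} {c : ℂ} {s : ℝ}
    (hb : ∀ z ∈ halfOpenSquare c s, ‖m z‖ ≤ 2) : IsCalderonZygmundFamily m c s [] := by
  refine ⟨by simp, by simp, by simp, fun h _ => ?_, fun h _ h0 => ?_⟩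
  · rw [List.map_nil, List.sum_nil, zero_add]
    refine (norm_integral_le_integral_norm _).trans_eq
      (setIntegral_congr_fun (measurableSet_halfOpenSquare c s) fun z hz => ?_)
    simp only [norm_mul]
    rw [min_eq_left (hb z hz)]
  · simpa using integral_nonneg h0

lemma isCalderonZygmundFamily_singleton {m : ℂ → ℂ} {c : ℂ} {s : ℝ} (hs : 0 < s)
    (h1 : s ^ 2 ≤ ∫ z in halfOpenSquare c s, ‖m z‖)
    (h2 : ∫ z in halfOpenSquare c s, ‖m z‖ ≤ 4 * s ^ 2) :
    IsCalderonZygmundFamily m c s [(c, s)] := by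
  refine ⟨by simpa, by simpa, by simpa, fun h _ => ?_, fun h _ h0 => by simp⟩
  have : 0 ≤ ∫ z in halfOpenSquare c s, min ‖m z‖ 2 * ‖h z‖ := by positivity
  simpa using this

lemma exists_isCalderonZygmundFamily_of_le {m : ℂ → ℂ} (hm : Continuous m) {δ : ℝ}
    (hδ : ∀ z w, ‖z - w‖ ≤ 2 * δ → ‖m z - m w‖ ≤ 1) (n : ℕ) :
    ∀ (c : ℂ) (s : ℝ), 0 < s → s ≤ δ * 2 ^ n → ∫ z in halfOpenSquare c s, ‖m z‖ ≤ s ^ 2 →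
      ∃ L, IsCalderonZygmundFamily m c s L := by
  induction n with
  | zero =>
    intro c s hs hsδ hle
    refine ⟨[], isCalderonZygmundFamily_nil fun z hz => ?_⟩
    have h1 : ∫ _ in halfOpenSquare c s, (‖m z‖ - 1) ≤ ∫ w in halfOpenSquare c s, ‖m w‖ := by
      refine setIntegral_mono_on (continuous_const.integrableOn_halfOpenSquare c s)
        (hm.norm.integrableOn_halfOpenSquare c s) (measurableSet_halfOpenSquare c s)
        fun w hw => ?_
      have h2 := hδ z w ((norm_sub_le_of_mem_halfOpenSquare hz hw).trans (by linarith))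
      have h3 := norm_sub_norm_le (m z) (m w)
      linarith
    rw [setIntegral_const, volume_real_halfOpenSquare c hs.le, smul_eq_mul] at h1
    nlinarith [pow_pos hs 2]
  | succ n ih =>
    intro c s hs hsδ hle
    have hquarter : ∀ c', ∫ z in halfOpenSquare c' (s / 2), ‖m z‖ ≤
        ∫ z in halfOpenSquare c s, ‖m z‖ → ∃ L, IsCalderonZygmundFamily m c' (s / 2) L := by
      intro c' hc'
      by_cases h : ∫ z in halfOpenSquare c' (s / 2), ‖m z‖ ≤ (s / 2) ^ 2
      · exact ih c' (s / 2) (by positivity) (by rw [pow_succ] at hsδ; linarith) h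
      · exact ⟨_, isCalderonZygmundFamily_singleton (by positivity) (not_le.1 h).le (by linarith)⟩
    have hnn : ∀ c', 0 ≤ ∫ z in halfOpenSquare c' (s / 2), ‖m z‖ := fun c' => by positivity
    have hsum := setIntegral_halfOpenSquare_eq hm.norm c hs.le
    have n1 := hnn c
    have n2 := hnn ⟨c.re, c.im + s / 2⟩
    have n3 := hnn ⟨c.re + s / 2, c.im⟩
    have n4 := hnn ⟨c.re + s / 2, c.im + s / 2⟩
    obtain ⟨L₁, h₁⟩ := hquarter c (by linarith)
    obtain ⟨L₂, h₂⟩ := hquarter ⟨c.re, c.im + s / 2⟩ (by linarith)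
    obtain ⟨L₃, h₃⟩ := hquarter ⟨c.re + s / 2, c.im⟩ (by linarith)
    obtain ⟨L₄, h₄⟩ := hquarter ⟨c.re + s / 2, c.im + s / 2⟩ (by linarith)
    refine ⟨L₁ ++ L₂ ++ (L₃ ++ L₄), ?_, ?_, ?_, fun h hh => ?_, fun h hh h0 => ?_⟩
    · simp only [List.mem_append]
      rintro q ((hq | hq) | (hq | hq))
      exacts [h₁.pos q hq, h₂.pos q hq, h₃.pos q hq, h₄.pos q hq]
    · simp only [List.mem_append]
      rintro q ((hq | hq) | (hq | hq))
      exacts [h₁.sq_le q hq, h₂.sq_le q hq, h₃.sq_le q hq, h₄.sq_le q hq]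
    · simp only [List.mem_append]
      rintro q ((hq | hq) | (hq | hq))
      exacts [h₁.le_sq q hq, h₂.le_sq q hq, h₃.le_sq q hq, h₄.le_sq q hq]
    · have hc : Continuous fun z => min ‖m z‖ 2 * ‖h z‖ := by fun_prop
      rw [setIntegral_halfOpenSquare_eq (h := fun z => m z * h z) (hm.mul hh) c hs.le,
        setIntegral_halfOpenSquare_eq hc c hs.le]
      simp only [List.map_append, List.sum_append]
      have i₁ := h₁.norm_integral_le h hh
      have i₂ := h₂.norm_integral_le h hh
      have i₃ := h₃.norm_integral_le h hh
      have i₄ := h₄.norm_integral_le h hh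
      refine (norm_add_le_of_le (norm_add_le_of_le i₁ i₂) (norm_add_le_of_le i₃ i₄)).trans_eq ?_
      ring
    · rw [setIntegral_halfOpenSquare_eq hh c hs.le]
      simp only [List.map_append, List.sum_append]
      have i₁ := h₁.sum_le h hh h0
      have i₂ := h₂.sum_le h hh h0
      have i₃ := h₃.sum_le h hh h0
      have i₄ := h₄.sum_le h hh h0
      linarith

lemma exists_isCalderonZygmundFamily {m : ℂ → ℂ} (hm : Continuous m) (hmc : HasCompactSupport m)
    {c : ℂ} {s : ℝ} (hs : 0 < s) (h : ∫ z in halfOpenSquare c s, ‖m z‖ ≤ s ^ 2) :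
    ∃ L, IsCalderonZygmundFamily m c s L := by
  obtain ⟨ε, hε, hu⟩ := Metric.uniformContinuous_iff.1
    (hmc.uniformContinuous_of_continuous hm) 1 one_pos
  obtain ⟨n, hn⟩ := pow_unbounded_of_one_lt (s / (ε / 4)) one_lt_two
  refine exists_isCalderonZygmundFamily_of_le hm (δ := ε / 4) (fun z w hzw => ?_) n c s hs ?_ h
  · rw [← dist_eq_norm] at hzw ⊢
    exact (hu (by linarith)).le
  · rw [div_lt_iff₀ (by positivity)] at hn
    linarith

lemma exists_smooth_cutoff (L : List (ℂ × ℝ)) (hL : ∀ q ∈ L, 0 < q.2) {S : Set ℂ}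
    (hS : volume S ≠ ⊤) :
    ∃ η : ℂ → ℝ, ContDiff ℝ (⊤ : ℕ∞) η ∧ (∀ z, 0 ≤ η z) ∧ (∀ z, η z ≤ 1) ∧
      (∀ q ∈ L, ∀ z ∈ Metric.closedBall q.1 (4 * q.2), η z = 0) ∧
      volume.real S - ∫ z in S, η z ≤ (L.map fun q => 25 * Real.pi * q.2 ^ 2).sum := by
  induction L with
  | nil => exact ⟨fun _ => 1, contDiff_const, by simp, by simp, by simp, by simp⟩
  | cons q L ih =>
    obtain ⟨η, hη, h0, h1, hz, hi⟩ := ih fun p hp => hL p (List.mem_cons_of_mem _ hp)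
    have hq : 0 < q.2 := hL q List.mem_cons_self
    let b : ContDiffBump q.1 := ⟨4 * q.2, 5 * q.2, by positivity, by linarith⟩
    have hbi : Integrable b := b.integrable
    have hηi : IntegrableOn η S := by
      refine IntegrableOn.of_bound hS.lt_top hη.continuous.aestronglyMeasurable 1
        (ae_of_all _ fun z => ?_)
      rw [Real.norm_of_nonneg (h0 z)]
      exact h1 z
    have hpi : IntegrableOn (fun z => (1 - b z) * η z) S := by
      refine IntegrableOn.of_bound hS.lt_top ((continuous_const.sub b.continuous).mul
        hη.continuous).aestronglyMeasurable 1 (ae_of_all _ fun z => ?_)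
      have := b.nonneg (x := z)
      have := b.le_one (x := z)
      rw [Real.norm_of_nonneg (mul_nonneg (by linarith) (h0 z))]
      exact mul_le_one₀ (by linarith) (h0 z) (h1 z)
    refine ⟨fun z => (1 - b z) * η z, (contDiff_const.sub b.contDiff).mul hη,
      fun z => mul_nonneg (by linarith [b.le_one (x := z)]) (h0 z),
      fun z => mul_le_one₀ (by linarith [b.nonneg (x := z)]) (h0 z) (h1 z), ?_, ?_⟩
    · intro p hp z hzp
      rcases List.mem_cons.1 hp with rfl | hp
      · simp [b.one_of_mem_closedBall hzp]
      · simp [hz p hp z hzp]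
    · have hle : ∫ z in S, b z ≤ 25 * Real.pi * q.2 ^ 2 := by
        refine (setIntegral_le_integral hbi (ae_of_all _ fun z => b.nonneg)).trans
          ((b.integral_le_measure_closedBall volume).trans_eq ?_)
        rw [measureReal_def, Complex.volume_closedBall]
        simp only [b, ENNReal.toReal_mul, ENNReal.toReal_pow, ENNReal.coe_toReal]
        rw [ENNReal.toReal_ofReal (by positivity)]
        simp
        ring
      have hmono : ∫ z in S, (η z - b z) ≤ ∫ z in S, (1 - b z) * η z := by
        refine integral_mono (hηi.sub hbi.integrableOn) hpi fun z => ?_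
        have := mul_le_mul_of_nonneg_left (h1 z) (b.nonneg (x := z))
        simp only
        linarith
      rw [integral_sub hηi hbi.integrableOn] at hmono
      rw [List.map_cons, List.sum_cons]
      linarith

lemma norm_setIntegral_mul_le_of_oscillation {m h : ℂ → ℂ} (hm : Continuous m)
    (hh : Continuous h) {c : ℂ} {s C t : ℝ} (hs : 0 < s) (ht : 0 < t) (hC : 0 ≤ C)
    (h1 : s ^ 2 ≤ ∫ z in halfOpenSquare c s, ‖m z‖)
    (h2 : ∫ z in halfOpenSquare c s, ‖m z‖ ≤ 4 * s ^ 2)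
    (hosc : ∀ z ∈ halfOpenSquare c s, ‖h z - h c‖ ≤ C) :
    ‖∫ z in halfOpenSquare c s, m z * h z‖ ≤
      ∫ z in halfOpenSquare c s, (4 * t * ‖h z‖ ^ 2 + (4 / t + 5 * C) * ‖m z‖) := by
  have hmS := measurableSet_halfOpenSquare c s
  have i1 := hm.norm.integrableOn_halfOpenSquare c s
  have i2 : IntegrableOn (fun z => ‖h z‖ ^ 2) (halfOpenSquare c s) :=
    (hh.norm.pow 2).integrableOn_halfOpenSquare c s
  have hv := volume_real_halfOpenSquare c hs.le
  have e1 : ‖∫ z in halfOpenSquare c s, m z * h z‖ ≤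
      (∫ z in halfOpenSquare c s, ‖m z‖) * (‖h c‖ + C) := by
    rw [← integral_mul_const]
    refine (norm_integral_le_integral_norm _).trans (setIntegral_mono_on
      ((hm.mul hh).norm.integrableOn_halfOpenSquare c s) (i1.mul_const _) hmS fun z hz => ?_)
    rw [norm_mul]
    gcongr
    have := norm_sub_norm_le (h z) (h c)
    linarith [hosc z hz]
  have e2 : ‖h c‖ * s ^ 2 ≤ (t * ∫ z in halfOpenSquare c s, ‖h z‖ ^ 2) + (1 / t + C) * s ^ 2 := by
    have : ∫ z in halfOpenSquare c s, ‖h c‖ ≤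
        ∫ z in halfOpenSquare c s, (t * ‖h z‖ ^ 2 + (1 / t + C)) := by
      refine setIntegral_mono_on (continuous_const.integrableOn_halfOpenSquare c s)
        ((by fun_prop : Continuous _).integrableOn_halfOpenSquare c s) hmS fun z hz => ?_
      have h3 := norm_sub_norm_le (h c) (h z)
      rw [norm_sub_rev] at h3
      have h4 : ‖h z‖ ≤ t * ‖h z‖ ^ 2 + 1 / t := by
        have h5 : t * ‖h z‖ ^ 2 + 1 / t - ‖h z‖ = ((t * ‖h z‖ - 1 / 2) ^ 2 + 3 / 4) / t := by
          field_simp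
          ring
        have : 0 ≤ ((t * ‖h z‖ - 1 / 2) ^ 2 + 3 / 4) / t := by positivity
        linarith
      linarith [hosc z hz]
    rw [setIntegral_const, hv, smul_eq_mul, integral_add (i2.const_mul t)
      (continuous_const.integrableOn_halfOpenSquare c s), integral_const_mul, setIntegral_const,
      hv, smul_eq_mul] at this
    linarith
  rw [integral_add (i2.const_mul _) (i1.const_mul _), integral_const_mul, integral_const_mul]
  set e := ∫ z in halfOpenSquare c s, ‖m z‖
  set a := ∫ z in halfOpenSquare c s, ‖h z‖ ^ 2
  have e3 : e * ‖h c‖ ≤ 4 * s ^ 2 * ‖h c‖ := by gcongr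
  have e4 : (1 / t + C) * s ^ 2 ≤ (1 / t + C) * e := by gcongr
  calc _ ≤ e * (‖h c‖ + C) := e1
    _ ≤ 4 * (t * a + (1 / t + C) * e) + C * e := by linarith
    _ = _ := by ring

lemma IsCalderonZygmundFamily.norm_integral_le_of_oscillation {m h : ℂ → ℂ} {c : ℂ} {s : ℝ}
    {L : List (ℂ × ℝ)} (hL : IsCalderonZygmundFamily m c s L) (hm : Continuous m)
    (hh : Continuous h) {C t : ℝ} (ht : 0 < t) (hC : 0 ≤ C)
    (hosc : ∀ q ∈ L, ∀ z ∈ halfOpenSquare q.1 q.2, ‖h z - h q.1‖ ≤ C) :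
    ‖∫ z in halfOpenSquare c s, m z * h z‖ ≤ 5 * t * (∫ z in halfOpenSquare c s, ‖h z‖ ^ 2) +
      (5 / t + 5 * C) * ∫ z in halfOpenSquare c s, ‖m z‖ := by
  have i1 := hm.norm.integrableOn_halfOpenSquare c s
  have i2 : IntegrableOn (fun z => ‖h z‖ ^ 2) (halfOpenSquare c s) :=
    (hh.norm.pow 2).integrableOn_halfOpenSquare c s
  have hsum : (L.map fun q => ‖∫ z in halfOpenSquare q.1 q.2, m z * h z‖).sum ≤
      ∫ z in halfOpenSquare c s, (4 * t * ‖h z‖ ^ 2 + (4 / t + 5 * C) * ‖m z‖) :=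
    (List.sum_le_sum fun q hq => norm_setIntegral_mul_le_of_oscillation hm hh (hL.pos q hq) ht hC
      (hL.sq_le q hq) (hL.le_sq q hq) (hosc q hq)).trans
      (hL.sum_le _ (by fun_prop) fun z => by positivity)
  have hmin : ∫ z in halfOpenSquare c s, min ‖m z‖ 2 * ‖h z‖ ≤
      ∫ z in halfOpenSquare c s, (t * ‖h z‖ ^ 2 + 1 / t * ‖m z‖) := by
    refine integral_mono ((by fun_prop : Continuous _).integrableOn_halfOpenSquare c s)
      ((by fun_prop : Continuous _).integrableOn_halfOpenSquare c s) fun z => ?_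
    simp only
    set u := min ‖m z‖ 2
    have hu0 : 0 ≤ u := le_min (norm_nonneg _) zero_le_two
    have hu : u ^ 2 ≤ 2 * ‖m z‖ := by
      rw [pow_two]
      exact mul_le_mul (min_le_right _ _) (min_le_left _ _) hu0 zero_le_two
    have h5 : t * ‖h z‖ ^ 2 + 1 / t * ‖m z‖ - u * ‖h z‖ =
        ((t * ‖h z‖ - u / 2) ^ 2 + (‖m z‖ - u ^ 2 / 4)) / t := by
      field_simp
      ring
    have : 0 ≤ ((t * ‖h z‖ - u / 2) ^ 2 + (‖m z‖ - u ^ 2 / 4)) / t := by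
      have : 0 ≤ ‖m z‖ - u ^ 2 / 4 := by linarith [norm_nonneg (m z)]
      positivity
    linarith
  rw [integral_add (i2.const_mul _) (i1.const_mul _), integral_const_mul, integral_const_mul]
    at hsum hmin
  refine (hL.norm_integral_le h hh).trans ((add_le_add hsum hmin).trans_eq ?_)
  ring

lemma halfOpenSquare_zero_one_subset_ball : halfOpenSquare 0 1 ⊆ Metric.ball 0 2 := by
  rintro z ⟨⟨h1, h2⟩, h3, h4⟩
  simp only [Complex.zero_re, Complex.zero_im, zero_add] at h1 h2 h3 h4
  have h5 := Complex.norm_le_abs_re_add_abs_im z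
  rw [abs_of_nonneg h1, abs_of_nonneg h3] at h5
  rw [mem_ball_zero_iff]
  linarith

/-- Lower bound for the energy `∫ ‖dzbar f‖ + (2 - |2 Re dz f|)⁺` of compactly supported maps of the
unit square. -/
lemma exists_le_setIntegral_norm_dzbar_add : ∃ c > (0 : ℝ), ∀ f : ℂ → ℂ,
    ContDiff ℝ (⊤ : ℕ∞) f → HasCompactSupport f → tsupport f ⊆ halfOpenSquare 0 1 →
    c ≤ ∫ z in halfOpenSquare 0 1, (‖dzbar f z‖ + max (2 - |2 * (dz f z).re|) 0) := by
  obtain ⟨A, hA, hAf⟩ := exists_setIntegral_norm_dz_cauchyTransform_sq_le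
  obtain ⟨C, hC, hCf⟩ := exists_norm_dz_cauchyTransform_sub_le
  set K : ℝ := 1 + 10 * (40 * A) + 10 * C + 25 * Real.pi / 2 with hK
  have hK1 : 1 ≤ K := by
    have := Real.pi_pos
    rw [hK, add_assoc, add_assoc]
    have : 0 ≤ 10 * (40 * A) + (10 * C + 25 * Real.pi / 2) := by positivity
    linarith
  refine ⟨1 / (4 * K), by positivity, fun f hf hfc hfs => ?_⟩
  have hm : Continuous (dzbar f) := hf.dzbar.continuous
  have hw : Continuous (dz f) := hf.dz.continuous
  set d : ℂ → ℝ := fun z => 2 * (dz f z).re with hd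
  have hds : ContDiff ℝ (⊤ : ℕ∞) d :=
    contDiff_const.mul (Complex.reCLM.contDiff.comp hf.dz)
  have hdc : Continuous d := hds.continuous
  set S := halfOpenSquare 0 1
  have hvol : volume.real S = 1 := by simpa using volume_real_halfOpenSquare 0 zero_le_one
  have i1 : IntegrableOn (fun z => ‖dzbar f z‖) S := hm.norm.integrableOn_halfOpenSquare 0 1
  have i2 : IntegrableOn (fun z => max (2 - |d z|) 0) S :=
    (by fun_prop : Continuous _).integrableOn_halfOpenSquare 0 1
  change _ ≤ ∫ z in S, (‖dzbar f z‖ + max (2 - |d z|) 0)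
  rw [integral_add i1 i2]
  set e := ∫ z in S, ‖dzbar f z‖ with he
  set p := ∫ z in S, max (2 - |d z|) 0 with hp
  have he0 : 0 ≤ e := by positivity
  have hp0 : 0 ≤ p := setIntegral_nonneg (measurableSet_halfOpenSquare 0 1) fun z _ =>
    le_max_right _ _
  by_cases he1 : 1 ≤ e
  · have : 1 / (4 * K) ≤ 1 := (div_le_one (by positivity)).2 (by linarith)
    linarith
  obtain ⟨L, hL⟩ := exists_isCalderonZygmundFamily hm hfc.dzbar (c := 0) one_pos
    (by rw [one_pow]; exact (not_le.1 he1).le)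
  have hSfin : volume S ≠ ⊤ := fun h => by simp [measureReal_def, h] at hvol
  obtain ⟨η, hη, hη0, hη1, hηz, hηi⟩ := exists_smooth_cutoff L hL.pos hSfin
  have hηc := hη.continuous
  rw [hvol, List.sum_map_mul_left] at hηi
  have hsq : (L.map fun q => q.2 ^ 2).sum ≤ e :=
    (List.sum_le_sum hL.sq_le).trans (hL.sum_le _ hm.norm fun z => norm_nonneg _)
  have hηe : 1 - 25 * Real.pi * e ≤ ∫ z in S, η z := by
    have := mul_le_mul_of_nonneg_left hsq (by positivity : 0 ≤ 25 * Real.pi)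
    linarith
  set g : ℂ → ℝ := fun z => η z * (d z / (1 + d z ^ 2)) with hg
  have hden : ∀ z, 1 + d z ^ 2 ≠ 0 := fun z => by positivity
  have hgs : ContDiff ℝ (⊤ : ℕ∞) g :=
    hη.mul (hds.div (contDiff_const.add (hds.pow 2)) hden)
  have hgc := hgs.continuous
  set ψ : ℂ → ℂ := fun z => (g z : ℂ) with hψ
  have hψs : ContDiff ℝ (⊤ : ℕ∞) ψ := Complex.ofRealCLM.contDiff.comp hgs
  have hψz : ∀ z, z ∉ tsupport f → ψ z = 0 := fun z hz => by
    simp [hψ, hg, hd, dz_eq_zero_of_notMem_tsupport hz]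
  have hψc : HasCompactSupport ψ := HasCompactSupport.intro' hfc (isClosed_tsupport f) hψz
  have hψt : tsupport ψ ⊆ Metric.ball 0 2 :=
    ((closure_minimal (Function.support_subset_iff'.2 hψz)
      (isClosed_tsupport f)).trans hfs).trans halfOpenSquare_zero_one_subset_ball
  have hψ1 : ∀ z, ‖ψ z‖ ≤ 1 := by
    intro z
    rw [hψ, Complex.norm_real, Real.norm_eq_abs, hg, abs_mul, abs_of_nonneg (hη0 z)]
    refine mul_le_one₀ (hη1 z) (abs_nonneg _) ?_
    rw [abs_div, abs_of_pos (by positivity : 0 < 1 + d z ^ 2), div_le_one (by positivity)]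
    nlinarith [sq_abs (d z), sq_nonneg (|d z| - 1)]
  have hΨs := hψs.cauchyTransform hψc
  have hh : Continuous (dz (cauchyTransform ψ)) := hΨs.dz.continuous
  have hA' : ∫ z in S, ‖dz (cauchyTransform ψ) z‖ ^ 2 ≤ A := by
    refine le_trans (setIntegral_mono_set ?_ (ae_of_all _ fun z => by positivity)
      halfOpenSquare_zero_one_subset_ball.eventuallyLE) (hAf ψ hψs hψc hψ1 hψt)
    exact ((hh.norm.pow 2).continuousOn.integrableOn_compact
      (isCompact_closedBall (0 : ℂ) 2)).mono_set Metric.ball_subset_closedBall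
  have hosc : ∀ q ∈ L, ∀ z ∈ halfOpenSquare q.1 q.2,
      ‖dz (cauchyTransform ψ) z - dz (cauchyTransform ψ) q.1‖ ≤ C := by
    intro q hq z hz
    have hq0 := hL.pos q hq
    refine hCf ψ hψs.continuous hψc hψ1 q.1 (2 * q.2) (by positivity) (fun w hw => ?_) z ?_
    · rw [← mul_assoc, show (2 : ℝ) * 2 = 4 by norm_num] at hw
      simp [hψ, hg, hηz q hq w hw]
    · rw [Metric.mem_closedBall, dist_eq_norm]
      exact norm_sub_le_of_mem_halfOpenSquare hz (self_mem_halfOpenSquare hq0)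
  have hmain := hL.norm_integral_le_of_oscillation hm hh (t := 1 / (40 * A)) (by positivity)
    hC.le hosc
  have hdual : ∫ z in S, d z * g z =
      2 * (∫ z in S, dzbar f z * dz (cauchyTransform ψ) z).re := by
    have h1 : ∫ z in S, dzbar f z * dz (cauchyTransform ψ) z = ∫ z in S, dz f z * ψ z := by
      rw [setIntegral_eq_integral_of_forall_compl_eq_zero fun z hz => by
          rw [dzbar_eq_zero_of_notMem_tsupport fun h => hz (hfs h), zero_mul],
        setIntegral_eq_integral_of_forall_compl_eq_zero fun z hz => by
          rw [dz_eq_zero_of_notMem_tsupport fun h => hz (hfs h), zero_mul],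
        ← integral_dz_mul_dzbar hf hfc hΨs]
      simp only [dzbar_cauchyTransform hψs hψc]
    have hwi : IntegrableOn (fun z => dz f z * ψ z) S :=
      (hw.mul hψs.continuous).integrableOn_halfOpenSquare 0 1
    have h2 : (∫ z in S, dz f z * ψ z).re = ∫ z in S, (dz f z * ψ z).re :=
      (integral_re hwi).symm
    rw [h1, h2, ← integral_const_mul]
    congr 1 with z
    rw [hψ, Complex.re_mul_ofReal, hd]
    ring
  have hpt : ∫ z in S, 1 / 2 * η z ≤ ∫ z in S, (max (2 - |d z|) 0 + d z * g z) := by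
    refine integral_mono ((by fun_prop : Continuous _).integrableOn_halfOpenSquare 0 1)
      ((by fun_prop : Continuous _).integrableOn_halfOpenSquare 0 1) fun z => ?_
    have h1 : 1 / 2 ≤ max (2 - |d z|) 0 + d z * (d z / (1 + d z ^ 2)) := by
      have hpos : 0 < 1 + d z ^ 2 := by positivity
      have hq : d z * (d z / (1 + d z ^ 2)) = d z ^ 2 / (1 + d z ^ 2) := by ring
      rcases le_total |d z| 1 with h | h
      · have := le_max_left (2 - |d z|) 0
        have : 0 ≤ d z ^ 2 / (1 + d z ^ 2) := by positivity
        linarith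
      · have h3 : 1 ≤ d z ^ 2 := by
          rw [← sq_abs]
          exact one_le_pow₀ h
        have := le_max_right (2 - |d z|) 0
        have : 1 / 2 ≤ d z ^ 2 / (1 + d z ^ 2) := by
          rw [le_div_iff₀ hpos]
          linarith
        linarith
    have h2 := mul_le_mul_of_nonneg_left h1 (hη0 z)
    have h3 := mul_le_mul_of_nonneg_right (hη1 z) (le_max_right (2 - |d z|) 0)
    simp only [hg]
    linarith
  have i3 : IntegrableOn (fun z => d z * g z) S := (hdc.mul hgc).integrableOn_halfOpenSquare 0 1
  rw [integral_const_mul, integral_add i2 i3, hdual] at hpt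
  have hre := (Complex.re_le_norm _).trans hmain
  have hA2 : 5 * (1 / (40 * A)) * ∫ z in S, ‖dz (cauchyTransform ψ) z‖ ^ 2 ≤ 1 / 8 := by
    calc _ ≤ 5 * (1 / (40 * A)) * A := by gcongr
      _ = 1 / 8 := by
        field_simp
        norm_num
  have h40 : 5 / (1 / (40 * A)) = 5 * (40 * A) := by rw [div_div_eq_mul_div, div_one]
  rw [h40] at hre
  rw [div_le_iff₀ (by positivity), hK]
  have hKp : 0 ≤ (10 * (40 * A) + 10 * C + 25 * Real.pi / 2) * p := by positivity
  linarith

/-- The real-linear identification of `ℂ` with `ℝ²`. -/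
noncomputable def complexEquivPi : ℂ ≃L[ℝ] (Fin 2 → ℝ) :=
  Complex.basisOneI.equivFun.toContinuousLinearEquiv

lemma complexEquivPi_apply (z : ℂ) : complexEquivPi z = ![z.re, z.im] := rfl

lemma complexEquivPi_symm_apply (x : Fin 2 → ℝ) :
    complexEquivPi.symm x = x 0 + x 1 * Complex.I :=
  Complex.measurableEquivPi_symm_apply x

/-- The map of the complex plane corresponding to `x ↦ k⁻¹ φ(x)`. -/
noncomputable def toComplexMap (k : ℝ) (φ : (Fin 2 → ℝ) → (Fin 2 → ℝ)) (z : ℂ) : ℂ :=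
  k⁻¹ • complexEquivPi.symm (φ (complexEquivPi z))

lemma fderiv_toComplexMap {φ : (Fin 2 → ℝ) → (Fin 2 → ℝ)} (hφ : Differentiable ℝ φ) (k : ℝ)
    (z v : ℂ) : fderiv ℝ (toComplexMap k φ) z v =
      k⁻¹ • complexEquivPi.symm (fderiv ℝ φ (complexEquivPi z) (complexEquivPi v)) := by
  have h := (complexEquivPi.symm.hasFDerivAt.comp z
    ((hφ _).hasFDerivAt.comp z complexEquivPi.hasFDerivAt)).const_smul k⁻¹
  rw [show toComplexMap k φ = k⁻¹ • (complexEquivPi.symm ∘ φ ∘ complexEquivPi) from rfl, h.fderiv]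
  rfl

lemma mul_norm_dzbar_add_le_gk {φ : (Fin 2 → ℝ) → (Fin 2 → ℝ)} (hφ : Differentiable ℝ φ) {k : ℝ}
    (hk : 0 < k) (z : ℂ) :
    k * (‖dzbar (toComplexMap k φ) z‖ + max (2 - |2 * (dz (toComplexMap k φ) z).re|) 0) ≤
      gk k (jacobianMatrix φ (complexEquivPi z)) := by
  have e1 : complexEquivPi 1 = Pi.single 0 1 := by
    ext i
    fin_cases i <;> simp [complexEquivPi_apply]
  have eI : complexEquivPi Complex.I = Pi.single 1 1 := by
    ext i
    fin_cases i <;> simp [complexEquivPi_apply]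
  have hJ : ∀ i j, fderiv ℝ φ (complexEquivPi z) (Pi.single j 1) i =
    jacobianMatrix φ (complexEquivPi z) i j := fun i j => rfl
  set J := jacobianMatrix φ (complexEquivPi z)
  have h1 : (dzbar (toComplexMap k φ) z).re = k⁻¹ * (J 0 0 - J 1 1) / 2 := by
    simp [dzbar, fderiv_toComplexMap hφ, e1, eI, complexEquivPi_symm_apply, hJ]
    ring
  have h2 : (dzbar (toComplexMap k φ) z).im = k⁻¹ * (J 0 1 + J 1 0) / 2 := by
    simp [dzbar, fderiv_toComplexMap hφ, e1, eI, complexEquivPi_symm_apply, hJ]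
    ring
  have h3 : 2 * (dz (toComplexMap k φ) z).re = k⁻¹ * (J 0 0 + J 1 1) := by
    simp [dz, fderiv_toComplexMap hφ, e1, eI, complexEquivPi_symm_apply, hJ]
    ring
  have h4 := mul_le_mul_of_nonneg_left
    (Complex.norm_le_abs_re_add_abs_im (dzbar (toComplexMap k φ) z)) hk.le
  rw [h1, h2, abs_div, abs_div, abs_mul, abs_mul, abs_of_pos (inv_pos.2 hk), abs_two] at h4
  have h5 : k * (k⁻¹ * |J 0 0 - J 1 1| / 2 + k⁻¹ * |J 0 1 + J 1 0| / 2) =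
      (|J 0 0 - J 1 1| + |J 0 1 + J 1 0|) / 2 := by
    field_simp
  have h6 : k * max (2 - |2 * (dz (toComplexMap k φ) z).re|) 0 =
      max (2 * k - |J 0 0 + J 1 1|) 0 := by
    rw [mul_max_of_nonneg _ _ hk.le, h3, abs_mul, abs_of_pos (inv_pos.2 hk)]
    congr 1
    · field_simp
    · ring
  rw [mul_add, h6, gk]
  have := abs_nonneg (J 0 0 - J 1 1)
  have := abs_nonneg (J 0 1 + J 1 0)
  linarith

lemma setIntegral_unitCube_two (h : (Fin 2 → ℝ) → ℝ) :
    ∫ x in unitCube 2, h x = ∫ z in halfOpenSquare 0 1, h (complexEquivPi z) := by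
  have hpre : halfOpenSquare 0 1 = Complex.measurableEquivPi ⁻¹'
      (Set.univ.pi fun _ => Set.Ico (0 : ℝ) 1) := by
    ext z
    simp [halfOpenSquare, Complex.mem_reProdIm, Fin.forall_fin_two]
  have hae : unitCube 2 =ᵐ[volume] Set.univ.pi fun _ : Fin 2 => Set.Ico (0 : ℝ) 1 :=
    (Measure.univ_pi_Ioo_ae_eq_Icc (f := fun _ => 0) (g := fun _ => 1)).trans
      (Measure.univ_pi_Ico_ae_eq_Icc (f := fun _ => 0) (g := fun _ => 1)).symm
  rw [setIntegral_congr_set hae, hpre]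
  exact (Complex.volume_preserving_equiv_pi.setIntegral_preimage_emb
    Complex.measurableEquivPi.measurableEmbedding h _).symm

/-- There are `c₁ > 0` and `k₀ > 0` such that for all `k ≥ k₀` the quasiconvex envelope of
`g_k` at `0` is at least `c₁ k`: every smooth compactly supported test map `φ` on the unit
square satisfies `∫_Q g_k(Dφ) ≥ c₁ k`. -/
theorem gk_quasiconvex_envelope_lower_bound :
    ∃ c₁ > (0 : ℝ), ∃ k₀ > (0 : ℝ), ∀ k : ℝ, k₀ ≤ k →
      ∀ φ : (Fin 2 → ℝ) → (Fin 2 → ℝ),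
        ContDiff ℝ (⊤ : ℕ∞) φ → HasCompactSupport φ → tsupport φ ⊆ unitCube 2 →
        c₁ * k ≤ ∫ x in unitCube 2, gk k (jacobianMatrix φ x) := by
  obtain ⟨c, hc, hcf⟩ := exists_le_setIntegral_norm_dzbar_add
  refine ⟨c, hc, 1, one_pos, fun k hk φ hφ hφc hφt => ?_⟩
  have hk0 : 0 < k := one_pos.trans_le hk
  have hφd : Differentiable ℝ φ := hφ.differentiable (by simp)
  have hf : ContDiff ℝ (⊤ : ℕ∞) (toComplexMap k φ) :=
    (complexEquivPi.symm.contDiff.comp (hφ.comp complexEquivPi.contDiff)).const_smul k⁻¹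
  have hz : ∀ z, z ∉ complexEquivPi ⁻¹' tsupport φ → toComplexMap k φ z = 0 := fun z hz => by
    simp [toComplexMap,
      image_eq_zero_of_notMem_tsupport (show complexEquivPi z ∉ tsupport φ from hz)]
  have hcl : IsClosed (complexEquivPi ⁻¹' tsupport φ) :=
    (isClosed_tsupport φ).preimage complexEquivPi.continuous
  have hcp : IsCompact (complexEquivPi ⁻¹' tsupport φ) :=
    complexEquivPi.toHomeomorph.isCompact_preimage.2 hφc
  have hsub : complexEquivPi ⁻¹' tsupport φ ⊆ halfOpenSquare 0 1 := by
    intro z hz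
    have h0 := hφt hz 0 (Set.mem_univ _)
    have h1 := hφt hz 1 (Set.mem_univ _)
    simp only [complexEquivPi_apply, Matrix.cons_val_zero, Matrix.cons_val_one] at h0 h1
    refine ⟨?_, ?_⟩ <;> simp [h0.1.le, h0.2, h1.1.le, h1.2]
  have hmain := hcf _ hf (HasCompactSupport.intro' hcp hcl hz)
    ((closure_minimal (Function.support_subset_iff'.2 hz) hcl).trans hsub)
  have hJ : ∀ i j, Continuous fun z => jacobianMatrix φ (complexEquivPi z) i j := by
    intro i j
    have h1 : Continuous fun x => fderiv ℝ φ x (Pi.single j 1) i :=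
      (continuous_apply i).comp ((hφ.continuous_fderiv (by simp)).clm_apply continuous_const)
    exact h1.comp complexEquivPi.continuous
  have hm := hf.dzbar.continuous
  have hw := hf.dz.continuous
  rw [setIntegral_unitCube_two, mul_comm]
  refine (mul_le_mul_of_nonneg_left hmain hk0.le).trans ?_
  rw [← integral_const_mul]
  refine integral_mono ((by fun_prop : Continuous _).integrableOn_halfOpenSquare 0 1)
    (Continuous.integrableOn_halfOpenSquare ?_ 0 1) fun z => mul_norm_dzbar_add_le_gk hφd hk0 z
  unfold gk
  fun_prop
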